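/- Perfect unlinkability of single-hop re-signatures: for all μ, x_i, x_j ∈ ZMod p with x_i ≠ 0 and x_j ≠ 0, the pushforward under the map t ↦ (g^(μ·x_i·t), g^(x_i·t), g^(t·x_i·x_j⁻¹)) of the uniform PMF on the nonzero elements of ZMod p (the distribution of Re-Sign's output) is equal to the pushforward under the map t ↦ (g^(μ·x_j·t), g^(x_j·t), g^t) of the uniform PMF on the nonzero elements of ZMod p (the distribution of a fresh level-2 signature under public key g^(x_j)). -/

import Mathlib

instance nonzero_nonempty (p : ℕ) [Fact p.Prime] : Nonempty {z : ZMod p // z ≠ 0} :=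
  ⟨⟨1, one_ne_zero⟩⟩

/-- Perfect unlinkability of single-hop re-signatures: the distribution of
Re-Sign's output `(g^(μ·x_i·t), g^(x_i·t), g^(t·x_i·x_j⁻¹))` for uniform
nonzero `t` equals the distribution of a fresh level-2 signature
`(g^(μ·x_j·t), g^(x_j·t), g^t)` for uniform nonzero `t`. -/
theorem stmt_2 {p : ℕ} [Fact p.Prime] {G : Type*} [CommGroup G]
    (g : G) (hg : orderOf g = p)
    (μ xi xj : ZMod p) (hxi : xi ≠ 0) (hxj : xj ≠ 0) :
    PMF.map
      (fun t : {z : ZMod p // z ≠ 0} =>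
        ((g ^ ((μ * xi * t.1).val), g ^ ((xi * t.1).val),
          g ^ ((t.1 * xi * xj⁻¹).val)) : G × G × G))
      (PMF.uniformOfFintype {z : ZMod p // z ≠ 0})
    =
    PMF.map
      (fun t : {z : ZMod p // z ≠ 0} =>
        ((g ^ ((μ * xj * t.1).val), g ^ ((xj * t.1).val),
          g ^ (t.1.val)) : G × G × G))
      (PMF.uniformOfFintype {z : ZMod p // z ≠ 0}) := by
  let e : {z : ZMod p // z ≠ 0} ≃ {z : ZMod p // z ≠ 0} :=
    { toFun := fun t => ⟨t.1 * xi * xj⁻¹, mul_ne_zero (mul_ne_zero t.2 hxi) (inv_ne_zero hxj)⟩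
      invFun := fun t => ⟨t.1 * xj * xi⁻¹, mul_ne_zero (mul_ne_zero t.2 hxj) (inv_ne_zero hxi)⟩
      left_inv := fun t => Subtype.ext (by
        change t.1 * xi * xj⁻¹ * xj * xi⁻¹ = t.1
        field_simp)
      right_inv := fun t => Subtype.ext (by
        change t.1 * xj * xi⁻¹ * xi * xj⁻¹ = t.1
        field_simp) }
  have he : PMF.map e (PMF.uniformOfFintype {z : ZMod p // z ≠ 0})
      = PMF.uniformOfFintype {z : ZMod p // z ≠ 0} := by
    ext b
    rw [PMF.map_apply, tsum_eq_single (e.symm b)]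
    · simp
    · intro a ha
      rw [if_neg]
      rintro rfl
      exact ha (e.symm_apply_apply a).symm
  conv_rhs => rw [← he, PMF.map_comp]
  congr 1
  funext t
  have h1 : μ * xi * t.1 = μ * xj * (t.1 * xi * xj⁻¹) := by field_simp
  have h2 : xi * t.1 = xj * (t.1 * xi * xj⁻¹) := by field_simp
  change _ = (g ^ ((μ * xj * (t.1 * xi * xj⁻¹)).val), g ^ ((xj * (t.1 * xi * xj⁻¹)).val),
          g ^ ((t.1 * xi * xj⁻¹).val))
  rw [← h1, ← h2]
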